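/- Let T′1 and T′2 be path covers of G with T′1 \ T′2 = {(v1,v2)} and T′2 \ T′1 = {(v4,v5)}, where v1, v2, v3, v4 are distinct, v5 ∉ {v2, v3, v4} (the case v5 = v1 is allowed), the two-edge path {(v2,v3), (v3,v4)} belongs to 𝒫(T′1 ∩ T′2), and 𝒫(T′1) ∩ 𝒫(T′2) ≠ ∅. Then there exist edge sets B′1, B′2 ⊆ E with B′1 ∩ B′2 = ∅ such that: (i) T′_i ∪ B′_i is a tour of G for i = 1,2; (ii) V(B′_i) = V1(T′_i) for i = 1,2; and (iii) B′1 ∪ B′2 consists of a (v2, v4)-path if v5 = v1, and, if v5 ≠ v1, of either vertex-disjoint (v1, v4)- and (v2, v5)-paths or vertex-disjoint (v1, v2)- and (v4, v5)-paths. Moreover, for any chosen common path O′1 ∈ 𝒫(T′1) ∩ 𝒫(T′2) and any prescribed labeling (z′1, w′1) of its two endpoints, the sets B′1 and B′2 can be chosen so that (v4, z′1) ∈ B′1 and (v2, w′1) ∈ B′2. -/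

import Mathlib

variable {V : Type*} [Fintype V] [DecidableEq V]

/-- The degree of vertex `v` in the edge set `F`. -/
def degE (F : Finset (Sym2 V)) (v : V) : ℕ := (F.filter (fun e => v ∈ e)).card

/-- The set of vertices incident to an edge of `F`. -/
def VsetE (F : Finset (Sym2 V)) : Set V := {v | ∃ e ∈ F, v ∈ e}

/-- Vertices incident to exactly one edge of `F`. -/
def V1E (F : Finset (Sym2 V)) : Set V := {v | degE F v = 1}

/-- Vertices incident to exactly two edges of `F`. -/
def V2E (F : Finset (Sym2 V)) : Set V := {v | degE F v = 2}

/-- All edges are genuine edges of the complete graph (no loops). -/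
def SimpleE (F : Finset (Sym2 V)) : Prop := ∀ e ∈ F, ¬ e.IsDiag

/-- `F` is spanning: every vertex is incident to an edge of `F`. -/
def SpanningE (F : Finset (Sym2 V)) : Prop := VsetE F = Set.univ

/-- `F` is a `k`-matching: every vertex has at most `k` incident edges. -/
def IsKMatching (k : ℕ) (F : Finset (Sym2 V)) : Prop :=
  SimpleE F ∧ ∀ v : V, degE F v ≤ k

/-- `F` is a `k`-factor: every vertex has exactly `k` incident edges. -/
def IsKFactor (k : ℕ) (F : Finset (Sym2 V)) : Prop :=
  SimpleE F ∧ ∀ v : V, degE F v = k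

/-- `F` is the edge set of a single (simple) cycle. -/
def IsCycleE (F : Finset (Sym2 V)) : Prop :=
  ∃ m : ℕ, 3 ≤ m ∧ ∃ f : ℕ → V,
    (∀ i < m, ∀ j < m, f i = f j → i = j) ∧
    F = (Finset.range m).image (fun i => s(f i, f ((i + 1) % m)))

/-- `F` contains no cycle. -/
def AcyclicE (F : Finset (Sym2 V)) : Prop :=
  ∀ C : Finset (Sym2 V), C ⊆ F → ¬ IsCycleE C

/-- `F` is the edge set of a simple path with endpoints `a` and `b`. -/
def IsPathE (F : Finset (Sym2 V)) (a b : V) : Prop :=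
  ∃ m : ℕ, 1 ≤ m ∧ ∃ f : ℕ → V,
    (∀ i ≤ m, ∀ j ≤ m, f i = f j → i = j) ∧ f 0 = a ∧ f m = b ∧
    F = (Finset.range m).image (fun i => s(f i, f (i + 1)))

/-- `P` is a maximal path of `F`, i.e. `P ∈ 𝒫(F)`. -/
def MaxPathE (F P : Finset (Sym2 V)) : Prop :=
  P ⊆ F ∧ (∃ a b : V, IsPathE P a b) ∧
  ∀ e ∈ F, (∃ v : V, v ∈ e ∧ v ∈ VsetE P) → e ∈ P

/-- `F` is a path cover: a spanning acyclic 2-matching. -/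
def IsPathCoverE (F : Finset (Sym2 V)) : Prop :=
  IsKMatching 2 F ∧ SpanningE F ∧ AcyclicE F

/-- `F` is a tour: the edge set of a Hamiltonian cycle. -/
def IsTourE (F : Finset (Sym2 V)) : Prop :=
  IsCycleE F ∧ SpanningE F

/-- Total length of the edge set `F`. -/
def lenE (ℓ : Sym2 V → ℝ) (F : Finset (Sym2 V)) : ℝ := ∑ e ∈ F, ℓ e

/-- Minimum length of a tour. -/
noncomputable def optE (ℓ : Sym2 V → ℝ) : ℝ :=
  sInf {x | ∃ H : Finset (Sym2 V), IsTourE H ∧ lenE ℓ H = x}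

/-- Maximum length of a tour. -/
noncomputable def worE (ℓ : Sym2 V → ℝ) : ℝ :=
  sSup {x | ∃ H : Finset (Sym2 V), IsTourE H ∧ lenE ℓ H = x}

/-- The set of edges of `F` incident to `v`. -/
def deltaE (F : Finset (Sym2 V)) (v : V) : Finset (Sym2 V) :=
  F.filter (fun e => v ∈ e)

/-- `(S, T)` is a valid pair of spanning 2-matchings. -/
def ValidPairE (S T : Finset (Sym2 V)) : Prop :=
  IsKMatching 2 S ∧ IsKMatching 2 T ∧ SpanningE S ∧ SpanningE T ∧
  AcyclicE T ∧
  (∀ v : V, v ∈ V2E S → v ∈ V2E T → deltaE S v = deltaE T v) ∧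
  (∀ C : Finset (Sym2 V), C ⊆ S → IsCycleE C →
    ∀ P : Finset (Sym2 V), MaxPathE T P → VsetE C ≠ VsetE P)



/-- The consecutive pairs of a vertex list. -/
def pathEdges {α : Type*} : List α → List (Sym2 α)
  | a :: b :: r => s(a, b) :: pathEdges (b :: r)
  | _ => []

/-- A nonempty vertex list together with its first vertex `z` and its last vertex `w`. -/
structure Seg (α : Type*) where
  z : α
  w : α
  l : List α
  hz : l.head? = some z
  hw : l.getLast? = some w

/-- The reversed segment. -/
def Seg.rev {α : Type*} (o : Seg α) : Seg α where
  z := o.w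
  w := o.z
  l := o.l.reverse
  hz := by simp [o.hw]
  hw := by simp [o.hz]

/-- Concatenation of two segments. -/
def Seg.app {α : Type*} (o m : Seg α) : Seg α where
  z := o.z
  w := m.w
  l := o.l ++ m.l
  hz := by simp [o.hz]
  hw := by simp [m.hw]

/-- All vertices of a list of segments. -/
def segVerts {α : Type*} (L : List (Seg α)) : List α := L.flatMap Seg.l

/-- All edges inside the segments of a list. -/
def segEdges {α : Type*} (L : List (Seg α)) : List (Sym2 α) :=
  L.flatMap fun o => pathEdges o.l

/-- The edges linking `a`, the consecutive segments of a list, and `b`. -/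
def linkEdges {α : Type*} (a : α) : List (Seg α) → α → List (Sym2 α)
  | [], b => [s(a, b)]
  | o :: r, b => s(a, o.z) :: linkEdges o.w r b

/-- The end vertices of a list of segments. -/
def segEnds {α : Type*} (L : List (Seg α)) : List α := L.flatMap fun o => [o.z, o.w]

/-- Two lists of segments with the same vertices and the same edges, up to order. -/
def SegEquiv {α : Type*} (L M : List (Seg α)) : Prop :=
  (segVerts L).Perm (segVerts M) ∧ (segEdges L).Perm (segEdges M)

section Lists

variable {α : Type*}

theorem mem_pathEdges_iff {l : List α} {e : Sym2 α} :
    e ∈ pathEdges l ↔ ∃ (i : ℕ) (h : i + 1 < l.length), e = s(l[i], l[i + 1]) := by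
  induction l with
  | nil => simp [pathEdges]
  | cons a r ih =>
    cases r with
    | nil => simp [pathEdges]
    | cons b r =>
      rw [pathEdges, List.mem_cons, ih]
      constructor
      · rintro (h | ⟨i, h, he⟩)
        · exact ⟨0, by simp, by simpa using h⟩
        · exact ⟨i + 1, by simpa using h, by simpa using he⟩
      · rintro ⟨i, h, he⟩
        cases i with
        | zero => left; simpa using he
        | succ i => right; exact ⟨i, by simpa using h, by simpa using he⟩

theorem mem_of_mem_pathEdges {l : List α} {e : Sym2 α} (he : e ∈ pathEdges l) {v : α}
    (hv : v ∈ e) : v ∈ l := by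
  obtain ⟨i, h, rfl⟩ := mem_pathEdges_iff.1 he
  rcases Sym2.mem_iff.1 hv with rfl | rfl <;> exact List.getElem_mem _

theorem pathEdges_append {l m : List α} {a b : α} (hl : l.getLast? = some a)
    (hm : m.head? = some b) :
    pathEdges (l ++ m) = pathEdges l ++ s(a, b) :: pathEdges m := by
  induction l with
  | nil => simp at hl
  | cons c r ih =>
    cases r with
    | nil =>
      obtain ⟨m', rfl⟩ : ∃ m', m = b :: m' := by
        cases m with
        | nil => simp at hm
        | cons x y => simp at hm; exact ⟨y, by rw [hm]⟩
      simp at hl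
      simp [pathEdges, hl]
    | cons d r =>
      have := ih (by simpa using hl)
      simp only [List.cons_append] at this ⊢
      simp [pathEdges, this]

theorem pathEdges_reverse_perm (l : List α) :
    (pathEdges l.reverse).Perm (pathEdges l) := by
  induction l with
  | nil => simp
  | cons a r ih =>
    cases r with
    | nil => simp
    | cons b r =>
      rw [List.reverse_cons, pathEdges_append (a := b) (b := a) (by simp) (by simp)]
      rw [pathEdges]
      have : pathEdges [a] = [] := rfl
      rw [this, Sym2.eq_swap]
      exact (List.perm_append_comm).trans (by simpa using ih)

theorem pathEdges_nodup {l : List α} (h : l.Nodup) : (pathEdges l).Nodup := by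
  induction l with
  | nil => simp [pathEdges]
  | cons a r ih =>
    cases r with
    | nil => simp [pathEdges]
    | cons b r =>
      rw [pathEdges, List.nodup_cons]
      rw [List.nodup_cons] at h
      exact ⟨fun hm => h.1 (mem_of_mem_pathEdges hm (Sym2.mem_mk_left a b)), ih h.2⟩

theorem exists_mem_pathEdges {l : List α} (h : 2 ≤ l.length) {v : α} (hv : v ∈ l) :
    ∃ e ∈ pathEdges l, v ∈ e := by
  obtain ⟨i, hi, rfl⟩ := List.getElem_of_mem hv
  by_cases h' : i + 1 < l.length
  · exact ⟨_, mem_pathEdges_iff.2 ⟨i, h', rfl⟩, Sym2.mem_mk_left _ _⟩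
  · obtain ⟨j, rfl⟩ : ∃ j, i = j + 1 := ⟨i - 1, by omega⟩
    exact ⟨_, mem_pathEdges_iff.2 ⟨j, hi, rfl⟩, Sym2.mem_mk_right _ _⟩

theorem eq_end_of_no_two_neighbors {l : List α} (h : l.Nodup) {u z w : α} (hu : u ∈ l)
    (hz : l.head? = some z) (hw : l.getLast? = some w)
    (hn : ∀ x y, s(u, x) ∈ pathEdges l → s(u, y) ∈ pathEdges l → x = y) :
    u = z ∨ u = w := by
  obtain ⟨i, hi, rfl⟩ := List.getElem_of_mem hu
  rcases Nat.eq_zero_or_pos i with rfl | h0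
  · left
    rw [List.head?_eq_getElem?, List.getElem?_eq_getElem hi] at hz
    exact Option.some.inj hz
  by_cases h' : i + 1 < l.length
  · obtain ⟨j, rfl⟩ : ∃ j, i = j + 1 := ⟨i - 1, by omega⟩
    have := hn l[j] l[j + 1 + 1] (mem_pathEdges_iff.2 ⟨j, hi, Sym2.eq_swap⟩)
      (mem_pathEdges_iff.2 ⟨j + 1, h', rfl⟩)
    rw [h.getElem_inj_iff] at this
    omega
  · right
    have hi' : i = l.length - 1 := by omega
    rw [List.getLast?_eq_getElem?, ← hi', List.getElem?_eq_getElem hi] at hw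
    exact Option.some.inj hw

theorem Seg.z_mem (o : Seg α) : o.z ∈ o.l := List.mem_of_head? o.hz

theorem Seg.w_mem (o : Seg α) : o.w ∈ o.l := List.mem_of_getLast? o.hw

theorem Seg.eq_singleton (o : Seg α) (h : o.l.Nodup) (hzw : o.z = o.w) : o.l = [o.z] := by
  obtain ⟨z, w, l, hz, hw⟩ := o
  dsimp only at *
  subst hzw
  cases l with
  | nil => simp at hz
  | cons a r =>
    simp at hz
    subst hz
    cases r with
    | nil => rfl
    | cons b r =>
      rw [List.getLast?_cons_cons] at hw
      exact absurd (List.mem_of_getLast? hw) (List.nodup_cons.1 h).1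

theorem Seg.ends_sublist (o : Seg α) (hzw : o.z ≠ o.w) : [o.z, o.w].Sublist o.l := by
  obtain ⟨z, w, l, hz, hw⟩ := o
  dsimp only at *
  cases l with
  | nil => simp at hz
  | cons a r =>
    simp at hz
    subst hz
    cases r with
    | nil => simp at hw; exact absurd hw hzw
    | cons b r =>
      rw [List.getLast?_cons_cons] at hw
      simpa using List.mem_of_getLast? hw

theorem segEnds_sublist {L : List (Seg α)} (h : ∀ o ∈ L, o.z ≠ o.w) :
    (segEnds L).Sublist (segVerts L) := by
  induction L with
  | nil => simp [segEnds, segVerts]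
  | cons o r ih =>
    have h1 := o.ends_sublist (h o (by simp))
    have h2 := ih fun p hp => h p (by simp [hp])
    exact h1.append h2

theorem Seg.rev_perm (o : Seg α) : o.rev.l.Perm o.l := List.reverse_perm _

theorem segVerts_cons (o : Seg α) (L : List (Seg α)) :
    segVerts (o :: L) = o.l ++ segVerts L := rfl

theorem segEdges_cons (o : Seg α) (L : List (Seg α)) :
    segEdges (o :: L) = pathEdges o.l ++ segEdges L := rfl

theorem segVerts_perm {L M : List (Seg α)} (h : L.Perm M) :
    (segVerts L).Perm (segVerts M) := h.flatMap_right _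

theorem segEdges_perm {L M : List (Seg α)} (h : L.Perm M) :
    (segEdges L).Perm (segEdges M) := h.flatMap_right _

theorem segVerts_map_rev_perm (L : List (Seg α)) :
    (segVerts (L.map Seg.rev)).Perm (segVerts L) := by
  induction L with
  | nil => simp
  | cons o r ih => exact o.rev_perm.append ih

theorem segEdges_map_rev_perm (L : List (Seg α)) :
    (segEdges (L.map Seg.rev)).Perm (segEdges L) := by
  induction L with
  | nil => simp
  | cons o r ih => exact (pathEdges_reverse_perm o.l).append ih

theorem Seg.pathEdges_app (o m : Seg α) :
    pathEdges (o.app m).l = pathEdges o.l ++ s(o.w, m.z) :: pathEdges m.l :=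
  pathEdges_append o.hw m.hz

theorem mem_segVerts_of_mem_segEdges {L : List (Seg α)} {e : Sym2 α} (he : e ∈ segEdges L)
    {v : α} (hv : v ∈ e) : v ∈ segVerts L := by
  obtain ⟨o, ho, he⟩ := List.mem_flatMap.1 he
  exact List.mem_flatMap.2 ⟨o, ho, mem_of_mem_pathEdges he hv⟩

theorem SegEquiv.trans {L M N : List (Seg α)} (h : SegEquiv L M) (h' : SegEquiv M N) :
    SegEquiv L N :=
  ⟨h.1.trans h'.1, h.2.trans h'.2⟩

theorem SegEquiv.of_perm {L M : List (Seg α)} (h : L.Perm M) : SegEquiv L M :=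
  ⟨segVerts_perm h, segEdges_perm h⟩

theorem SegEquiv.cons {L M : List (Seg α)} (o : Seg α) (h : SegEquiv L M) :
    SegEquiv (o :: L) (o :: M) :=
  ⟨h.1.append_left _, h.2.append_left _⟩

theorem SegEquiv.rev_cons {L M : List (Seg α)} (o : Seg α) (h : SegEquiv L M) :
    SegEquiv (o.rev :: L) (o :: M) :=
  ⟨o.rev_perm.append h.1, (pathEdges_reverse_perm o.l).append h.2⟩

theorem SegEquiv.map_rev (L : List (Seg α)) : SegEquiv (L.map Seg.rev) L :=
  ⟨segVerts_map_rev_perm L, segEdges_map_rev_perm L⟩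

/-- A one-vertex segment is isolated. -/
theorem Seg.z_ne_w {o : Seg α} {L : List (Seg α)} (ho : o ∈ L) (hnd : (segVerts L).Nodup)
    (hc : ∃ e ∈ segEdges L, o.z ∈ e) : o.z ≠ o.w := by
  intro h
  obtain ⟨A, B, rfl⟩ := List.append_of_mem ho
  have hp : (o :: (A ++ B)).Perm (A ++ o :: B) := List.perm_middle.symm
  rw [← (segVerts_perm hp).nodup_iff, segVerts_cons, List.nodup_append'] at hnd
  obtain ⟨e, he, hv⟩ := hc
  rw [← (segEdges_perm hp).mem_iff, segEdges_cons, o.eq_singleton hnd.1 h,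
    List.mem_append] at he
  rcases he with he | he
  · simp [pathEdges] at he
  · exact hnd.2.2 o.z_mem (mem_segVerts_of_mem_segEdges he hv)

/-- A vertex with at most one neighbour can be made the last vertex of the first segment. -/
theorem exists_seg_last {L : List (Seg α)} (hnd : (segVerts L).Nodup) {u : α}
    (hu : u ∈ segVerts L)
    (hn : ∀ x y, s(u, x) ∈ segEdges L → s(u, y) ∈ segEdges L → x = y) :
    ∃ (o : Seg α) (M : List (Seg α)), o.w = u ∧ SegEquiv (o :: M) L := by
  obtain ⟨o, ho, huo⟩ := List.mem_flatMap.1 hu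
  obtain ⟨A, B, rfl⟩ := List.append_of_mem ho
  have hp : SegEquiv (o :: (A ++ B)) (A ++ o :: B) := .of_perm List.perm_middle.symm
  have hnd' := hp.1.nodup_iff.2 hnd
  rw [segVerts_cons, List.nodup_append'] at hnd'
  have hmem : ∀ e ∈ pathEdges o.l, e ∈ segEdges (A ++ o :: B) := fun e he =>
    List.mem_flatMap.2 ⟨o, ho, he⟩
  rcases eq_end_of_no_two_neighbors hnd'.1 huo o.hz o.hw
    (fun x y hx hy => hn x y (hmem _ hx) (hmem _ hy)) with h | h
  · exact ⟨o.rev, A ++ B, h.symm, (SegEquiv.rev_cons o (.of_perm (.refl _))).trans hp⟩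
  · exact ⟨o, A ++ B, h.symm, hp⟩

theorem linkEdges_append_singleton (a : α) (L : List (Seg α)) (o : Seg α) (b : α) :
    (linkEdges a (L ++ [o]) b).Perm (s(o.w, b) :: linkEdges a L o.z) := by
  induction L generalizing a with
  | nil => exact List.Perm.swap _ _ _
  | cons p r ih => exact ((ih p.w).cons _).trans (List.Perm.swap _ _ _)

/-- Concatenating all segments adds exactly the linking edges. -/
theorem exists_last_link (o : Seg α) (L : List (Seg α)) :
    ∃ w, (segVerts (o :: L)).getLast? = some w ∧ ∀ b,
      (s(w, b) :: pathEdges (segVerts (o :: L))).Perm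
        (segEdges (o :: L) ++ linkEdges o.w L b) := by
  induction L generalizing o with
  | nil =>
    refine ⟨o.w, by simpa [segVerts] using o.hw, fun b => ?_⟩
    simpa [segVerts, segEdges, linkEdges] using
      (List.perm_append_singleton s(o.w, b) (pathEdges o.l)).symm
  | cons p r ih =>
    obtain ⟨w, hw, h⟩ := ih p
    refine ⟨w, by rw [segVerts_cons, List.getLast?_append, hw]; rfl, fun b => ?_⟩
    have hh : (segVerts (p :: r)).head? = some p.z := by
      rw [segVerts_cons, List.head?_append, p.hz]; rfl
    rw [segVerts_cons o, pathEdges_append o.hw hh, segEdges_cons o, linkEdges]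
    have h' := h b
    rw [← Multiset.coe_eq_coe] at h' ⊢
    simp only [← Multiset.cons_coe, ← Multiset.coe_add] at h' ⊢
    rw [Multiset.add_cons, Multiset.cons_swap, ← Multiset.add_cons, h', Multiset.add_cons,
      add_assoc]

/-- The links of the segments and of the reversed segments form two paths. -/
theorem exists_strands (L : List (Seg α)) (a b X Y : α) :
    ∃ (l₁ l₂ : List α) (X' Y' : α), (X' = X ∧ Y' = Y ∨ X' = Y ∧ Y' = X) ∧
      (l₁ ++ l₂).Perm (segEnds L) ∧
      (linkEdges a L X ++ linkEdges b (L.map Seg.rev) Y).Perm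
        (pathEdges (a :: l₁ ++ [X']) ++ pathEdges (b :: l₂ ++ [Y'])) := by
  induction L generalizing a b with
  | nil => exact ⟨[], [], X, Y, Or.inl ⟨rfl, rfl⟩, by simp [segEnds], by
      simp [linkEdges, pathEdges]⟩
  | cons o r ih =>
    obtain ⟨l₁, l₂, X', Y', hXY, hp, he⟩ := ih o.w o.z
    refine ⟨o.z :: l₂, o.w :: l₁, Y', X', hXY.symm.imp And.symm And.symm, ?_, ?_⟩
    · have : segEnds (o :: r) = o.z :: o.w :: segEnds r := rfl
      rw [this, ← Multiset.coe_eq_coe]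
      rw [← Multiset.coe_eq_coe] at hp
      simp only [← Multiset.cons_coe, ← Multiset.coe_add, Multiset.cons_add,
        Multiset.add_cons] at hp ⊢
      rw [← hp, add_comm (l₂ : Multiset α), Multiset.cons_swap]
    · simp only [List.map_cons, linkEdges, List.cons_append, pathEdges] at he ⊢
      rw [← Multiset.coe_eq_coe] at he ⊢
      simp only [← Multiset.cons_coe, ← Multiset.coe_add, Multiset.add_cons] at he ⊢
      rw [add_comm (_ : Multiset (Sym2 α)) (pathEdges (o.w :: _) : Multiset (Sym2 α)), ← he]
      rfl

end Lists

section EdgeSets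

variable {α : Type*} [DecidableEq α]

theorem exists_list_of_isPathE {P : Finset (Sym2 α)} {a b : α} (h : IsPathE P a b) :
    ∃ l : List α, l.Nodup ∧ 2 ≤ l.length ∧ l.head? = some a ∧ l.getLast? = some b ∧
      (pathEdges l).toFinset = P := by
  obtain ⟨m, hm, f, hf, rfl, rfl, rfl⟩ := h
  refine ⟨(List.range (m + 1)).map f, ?_, by simpa using hm, ?_, ?_, ?_⟩
  · refine List.Nodup.map_on (fun x hx y hy h => hf x ?_ y ?_ h) List.nodup_range
    · simpa [Nat.lt_succ_iff] using hx
    · simpa [Nat.lt_succ_iff] using hy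
  · simp [List.head?_range]
  · simp [List.getLast?_range]
  · ext e
    simp [mem_pathEdges_iff, eq_comm]

theorem isPathE_of_list {l : List α} (hnd : l.Nodup) (hl : 2 ≤ l.length) {a b : α}
    (ha : l.head? = some a) (hb : l.getLast? = some b) :
    IsPathE (pathEdges l).toFinset a b := by
  have hg : ∀ i (h : i < l.length), l.getD i a = l[i] := fun i h => by simp [h]
  rw [List.head?_eq_getElem?] at ha
  rw [List.getLast?_eq_getElem?] at hb
  refine ⟨l.length - 1, by omega, fun i => l.getD i a, ?_, ?_, ?_, ?_⟩
  · intro i hi j hj h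
    dsimp only at h
    rw [hg i (by omega), hg j (by omega)] at h
    exact hnd.getElem_inj_iff.1 h
  · simp [List.getD, ha]
  · simp [List.getD, hb]
  · ext e
    simp only [List.mem_toFinset, mem_pathEdges_iff, Finset.mem_image, Finset.mem_range]
    constructor
    · rintro ⟨i, h, rfl⟩
      exact ⟨i, by omega, by rw [hg, hg]⟩
    · rintro ⟨i, h, rfl⟩
      exact ⟨i, by omega, by rw [hg, hg]⟩

theorem isCycleE_of_list {l : List α} (hnd : l.Nodup) (hl : 3 ≤ l.length) {a b : α}
    (ha : l.head? = some a) (hb : l.getLast? = some b) :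
    IsCycleE (s(b, a) :: pathEdges l).toFinset := by
  have hg : ∀ i (h : i < l.length), l.getD i a = l[i] := fun i h => by simp [h]
  rw [List.head?_eq_getElem?, List.getElem?_eq_getElem (by omega), Option.some.injEq] at ha
  rw [List.getLast?_eq_getElem?, List.getElem?_eq_getElem (by omega), Option.some.injEq] at hb
  refine ⟨l.length, hl, fun i => l.getD i a, ?_, ?_⟩
  · intro i hi j hj h
    dsimp only at h
    rw [hg i hi, hg j hj] at h
    exact hnd.getElem_inj_iff.1 h
  · ext e
    simp only [List.mem_toFinset, List.mem_cons, mem_pathEdges_iff, Finset.mem_image,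
      Finset.mem_range]
    constructor
    · rintro (rfl | ⟨i, h, rfl⟩)
      · refine ⟨l.length - 1, by omega, ?_⟩
        have : (l.length - 1 + 1) % l.length = 0 := by
          rw [Nat.sub_add_cancel (by omega), Nat.mod_self]
        rw [this, hg _ (by omega), hg _ (by omega), ha, hb]
      · exact ⟨i, by omega, by rw [Nat.mod_eq_of_lt h, hg _ (by omega), hg _ h]⟩
    · rintro ⟨i, h, rfl⟩
      rcases Nat.lt_or_ge (i + 1) l.length with h' | h'
      · right
        exact ⟨i, h', by rw [Nat.mod_eq_of_lt h', hg _ (by omega), hg _ h']⟩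
      · left
        have hi : i = l.length - 1 := by omega
        have : (i + 1) % l.length = 0 := by
          rw [hi, Nat.sub_add_cancel (by omega), Nat.mod_self]
        rw [this, hg _ (by omega), hg _ (by omega), ha, ← hb]
        simp only [hi]

theorem IsCycleE.degE_eq_two {C : Finset (Sym2 α)} (hC : IsCycleE C) {v : α}
    (hv : v ∈ VsetE C) : degE C v = 2 := by
  obtain ⟨m, hm, f, hf, rfl⟩ := hC
  obtain ⟨k, hk, rfl⟩ : ∃ k < m, f k = v := by
    obtain ⟨e, he, hve⟩ := hv
    obtain ⟨i, hi, rfl⟩ := Finset.mem_image.1 he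
    rw [Finset.mem_range] at hi
    rcases Sym2.mem_iff.1 hve with h | h
    · exact ⟨i, hi, h.symm⟩
    · exact ⟨_, Nat.mod_lt _ (by omega), h.symm⟩
  have hsucc : ∀ i < m, (i + 1) % m = if i + 1 = m then 0 else i + 1 := by
    intro i hi
    split_ifs with h
    · rw [h, Nat.mod_self]
    · exact Nat.mod_eq_of_lt (by omega)
  obtain ⟨j, hj, hjk⟩ : ∃ j < m, (j + 1) % m = k := by
    rcases Nat.eq_zero_or_pos k with rfl | h0
    · exact ⟨m - 1, by omega, by rw [hsucc _ (by omega), if_pos (by omega)]⟩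
    · exact ⟨k - 1, by omega, by rw [hsucc _ (by omega), if_neg (by omega)]; omega⟩
  have hlt : ∀ i, (i + 1) % m < m := fun i => Nat.mod_lt _ (by omega)
  have : ((Finset.range m).image fun i => s(f i, f ((i + 1) % m))).filter (f k ∈ ·) =
      {s(f k, f ((k + 1) % m)), s(f j, f k)} := by
    ext e
    simp only [Finset.mem_filter, Finset.mem_image, Finset.mem_range, Finset.mem_insert,
      Finset.mem_singleton]
    constructor
    · rintro ⟨⟨i, hi, rfl⟩, he⟩
      rcases Sym2.mem_iff.1 he with h | h
      · left; rw [hf k hk i hi h]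
      · right
        have h2 := hf k hk _ (hlt i) h
        have : i = j := by
          have a1 := hsucc i hi
          have a2 := hsucc j hj
          split_ifs at a1 a2 <;> omega
        rw [this, hjk]
    · rintro (rfl | rfl)
      · exact ⟨⟨k, hk, rfl⟩, Sym2.mem_mk_left _ _⟩
      · exact ⟨⟨j, hj, by rw [hjk]⟩, Sym2.mem_mk_right _ _⟩
  rw [degE, this, Finset.card_pair]
  intro h
  have hkj : k ≠ j := by
    rintro rfl
    have := hsucc k hk
    split_ifs at this <;> omega
  rcases Sym2.eq_iff.1 h with ⟨h1, -⟩ | ⟨-, h1⟩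
  · exact hkj (hf k hk j hj h1)
  · have h2 := hf _ (hlt k) j hj h1
    have a1 := hsucc k hk
    have a2 := hsucc j hj
    split_ifs at a1 a2 <;> omega

theorem eq_or_eq_of_degE_le_two {F : Finset (Sym2 α)} {u x y c : α} (h : degE F u ≤ 2)
    (hx : s(u, x) ∈ F) (hy : s(u, y) ∈ F) (hc : s(u, c) ∈ F) (hxc : x ≠ c) (hyc : y ≠ c) :
    x = y := by
  by_contra hxy
  have hsub : ({s(u, x), s(u, y), s(u, c)} : Finset (Sym2 α)) ⊆ F.filter (u ∈ ·) := by
    intro e he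
    simp only [Finset.mem_insert, Finset.mem_singleton] at he
    rcases he with rfl | rfl | rfl <;> simp [*]
  have h3 : ({s(u, x), s(u, y), s(u, c)} : Finset (Sym2 α)).card = 3 := by
    rw [Finset.card_eq_three]
    exact ⟨_, _, _, mt Sym2.congr_right.1 hxy, mt Sym2.congr_right.1 hxc,
      mt Sym2.congr_right.1 hyc, rfl⟩
  have := Finset.card_le_card hsub
  rw [h3] at this
  exact absurd (this.trans h) (by norm_num)

theorem AcyclicE.mono {F H : Finset (Sym2 α)} (h : AcyclicE H) (hFH : F ⊆ H) :
    AcyclicE F :=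
  fun C hC => h C (hC.trans hFH)

theorem IsKMatching.mono {k : ℕ} {F H : Finset (Sym2 α)} (h : IsKMatching k H)
    (hFH : F ⊆ H) : IsKMatching k F :=
  ⟨fun e he => h.1 e (hFH he),
    fun v => (Finset.card_le_card (Finset.filter_subset_filter _ hFH)).trans (h.2 v)⟩

/-- An acyclic 2-matching decomposes its vertex set into segments. -/
theorem exists_segs (S : Finset α) (F : Finset (Sym2 α)) (hF : IsKMatching 2 F)
    (hac : AcyclicE F) (hS : ∀ e ∈ F, ∀ v ∈ e, v ∈ S) :
    ∃ L : List (Seg α), (segVerts L).Nodup ∧ (∀ v, v ∈ segVerts L ↔ v ∈ S) ∧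
      ∀ e, e ∈ segEdges L ↔ e ∈ F := by
  induction F using Finset.induction_on with
  | empty =>
    let g : α → Seg α := fun v => ⟨v, v, [v], rfl, rfl⟩
    refine ⟨S.toList.map g, ?_, ?_, ?_⟩
    · have : segVerts (S.toList.map g) = S.toList := by
        simp [segVerts, List.flatMap_map, g]
      rw [this]
      exact S.nodup_toList
    · simp [segVerts, List.flatMap_map, g]
    · simp [segEdges, List.flatMap_map, g, pathEdges]
  | insert e F he ih =>
    have hsub : F ⊆ insert e F := Finset.subset_insert e F
    obtain ⟨L, hnd, hv, hE⟩ := ih (hF.mono hsub) (hac.mono hsub)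
      fun d hd => hS d (hsub hd)
    induction e using Sym2.ind with
    | _ u v =>
    have huv : u ≠ v := by
      have := hF.1 s(u, v) (by simp)
      simpa using this
    have hu : u ∈ segVerts L := (hv u).2 (hS s(u, v) (by simp) u (by simp))
    have hvL : v ∈ segVerts L := (hv v).2 (hS s(u, v) (by simp) v (by simp))
    obtain ⟨o, M, how, hM1, hM2⟩ := exists_seg_last hnd hu fun x y hx hy => by
      rw [hE] at hx hy
      refine eq_or_eq_of_degE_le_two (hF.2 u) (hsub hx) (hsub hy) (c := v) (by simp) ?_ ?_
      · rintro rfl; exact he hx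
      · rintro rfl; exact he hy
    have hdv : ∀ x y, s(v, x) ∈ segEdges (o :: M) → s(v, y) ∈ segEdges (o :: M) → x = y := by
      intro x y hx hy
      rw [hM2.mem_iff, hE] at hx hy
      refine eq_or_eq_of_degE_le_two (hF.2 v) (hsub hx) (hsub hy) (c := u)
        (by simp [Sym2.eq_swap]) ?_ ?_
      · rintro rfl; rw [Sym2.eq_swap] at hx; exact he hx
      · rintro rfl; rw [Sym2.eq_swap] at hy; exact he hy
    have hnd' := hM1.nodup_iff.2 hnd
    rw [segVerts_cons, List.nodup_append'] at hnd'
    have hoM := hM1.mem_iff.2 hvL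
    rw [segVerts_cons, List.mem_append] at hoM
    rcases hoM with hvo | hvM
    · exfalso
      have hvz : v = o.z := (eq_end_of_no_two_neighbors hnd'.1 hvo o.hz o.hw
        fun x y hx hy => hdv x y (by simp [segEdges_cons, hx])
          (by simp [segEdges_cons, hy])).resolve_right fun h => huv (how.symm.trans h.symm)
      have hsubE : ∀ d ∈ pathEdges o.l, d ∈ F := fun d hd =>
        (hE d).1 (hM2.mem_iff.1 (by simp [segEdges_cons, hd]))
      have hlen : 3 ≤ o.l.length := by
        obtain ⟨z, w, l, hz, hw⟩ := o
        dsimp only at *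
        subst how hvz
        match l with
        | [] => simp at hz
        | [a] => simp at hz hw; exact absurd (hw.symm.trans hz) huv
        | [a, b] =>
          simp at hz hw
          subst hz hw
          exact absurd (hsubE s(a, b) (by simp [pathEdges])) (by rwa [Sym2.eq_swap])
        | _ :: _ :: _ :: _ => simp
      refine hac _ ?_ (isCycleE_of_list hnd'.1 hlen o.hz o.hw)
      intro d hd
      simp only [List.mem_toFinset, List.mem_cons] at hd
      rcases hd with rfl | hd
      · rw [how, ← hvz]; simp
      · exact hsub (hsubE d hd)
    · obtain ⟨p, N, hpw, hN1, hN2⟩ := exists_seg_last hnd'.2.1 hvM fun x y hx hy =>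
        hdv x y (by simp [segEdges_cons, hx]) (by simp [segEdges_cons, hy])
      have hV : (segVerts (o.app p.rev :: N)).Perm (segVerts L) := by
        refine List.Perm.trans ?_ hM1
        rw [segVerts_cons, segVerts_cons o]
        refine List.Perm.trans ?_ (hN1.append_left o.l)
        rw [segVerts_cons, ← List.append_assoc]
        exact (p.rev_perm.append_left o.l).append_right _
      refine ⟨o.app p.rev :: N, hV.nodup_iff.2 hnd, fun x => hV.mem_iff.trans (hv x), ?_⟩
      intro d
      have h1 : s(o.w, p.rev.z) = s(u, v) := by rw [how]; exact congrArg _ hpw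
      rw [segEdges_cons, Seg.pathEdges_app, h1, Finset.mem_insert, ← hE, ← hM2.mem_iff,
        segEdges_cons o, List.mem_append (t := segEdges M), ← hN2.mem_iff, segEdges_cons]
      have h2 := (pathEdges_reverse_perm p.l).mem_iff (a := d)
      simp only [List.mem_append, List.mem_cons]
      rw [show p.rev.l = p.l.reverse from rfl, h2]
      tauto

/-- Linking the segments of a path cover cyclically yields a tour. -/
theorem tour_of_segs (T : Finset (Sym2 α)) (hT : SpanningE T) (o : Seg α) (L : List (Seg α))
    (hnd : (segVerts (o :: L)).Nodup)
    (hlen : 3 ≤ (segVerts (o :: L)).length) (hE : ∀ e, e ∈ segEdges (o :: L) ↔ e ∈ T) :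
    IsTourE (T ∪ (linkEdges o.w L o.z).toFinset) ∧
      VsetE (linkEdges o.w L o.z).toFinset = V1E T := by
  obtain ⟨w, hw, hp⟩ := exists_last_link o L
  have hz : (segVerts (o :: L)).head? = some o.z := by
    rw [segVerts_cons, List.head?_append, o.hz]; rfl
  have hcyc := isCycleE_of_list hnd hlen hz hw
  have hnodup : (s(w, o.z) :: pathEdges (segVerts (o :: L))).Nodup := by
    rw [List.nodup_cons]
    refine ⟨fun hm => ?_, pathEdges_nodup hnd⟩
    obtain ⟨i, hi, he⟩ := mem_pathEdges_iff.1 hm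
    rw [List.head?_eq_getElem?, List.getElem?_eq_getElem (by omega), Option.some.injEq] at hz
    rw [List.getLast?_eq_getElem?, List.getElem?_eq_getElem (by omega), Option.some.injEq] at hw
    rw [← hz, ← hw] at he
    rcases Sym2.eq_iff.1 he with ⟨h1, h2⟩ | ⟨h1, h2⟩ <;>
      rw [hnd.getElem_inj_iff] at h1 h2 <;> omega
  rw [(hp o.z).nodup_iff, List.nodup_append'] at hnodup
  have hC : (s(w, o.z) :: pathEdges (segVerts (o :: L))).toFinset =
      T ∪ (linkEdges o.w L o.z).toFinset := by
    ext e
    rw [List.mem_toFinset, (hp o.z).mem_iff, List.mem_append, hE, Finset.mem_union,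
      List.mem_toFinset]
  rw [hC] at hcyc
  have hsp : SpanningE (T ∪ (linkEdges o.w L o.z).toFinset) := by
    refine Set.eq_univ_of_forall fun v => ?_
    obtain ⟨e, he, hve⟩ : v ∈ VsetE T := hT ▸ Set.mem_univ v
    exact ⟨e, Finset.mem_union_left _ he, hve⟩
  refine ⟨⟨hcyc, hsp⟩, ?_⟩
  have hdisj : Disjoint T (linkEdges o.w L o.z).toFinset := by
    rw [Finset.disjoint_left]
    intro e he he'
    exact hnodup.2.2 ((hE e).2 he) (List.mem_toFinset.1 he')
  ext v
  have h2 := hcyc.degE_eq_two (v := v) (hsp ▸ Set.mem_univ v)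
  have h1 : 0 < degE T v := by
    obtain ⟨e, he, hve⟩ : v ∈ VsetE T := hT ▸ Set.mem_univ v
    exact Finset.card_pos.2 ⟨e, Finset.mem_filter.2 ⟨he, hve⟩⟩
  have hB : v ∈ VsetE (linkEdges o.w L o.z).toFinset ↔
      0 < degE (linkEdges o.w L o.z).toFinset v := by
    rw [degE, Finset.card_pos]
    exact ⟨fun ⟨e, he, hve⟩ => ⟨e, Finset.mem_filter.2 ⟨he, hve⟩⟩,
      fun ⟨e, he⟩ => ⟨e, (Finset.mem_filter.1 he).1, (Finset.mem_filter.1 he).2⟩⟩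
  rw [degE, Finset.filter_union, Finset.card_union_of_disjoint
    (Finset.disjoint_filter_filter hdisj)] at h2
  rw [hB]
  change _ ↔ degE T v = 1
  unfold degE at *
  omega

theorem IsPathE.symm {P : Finset (Sym2 α)} {a b : α} (h : IsPathE P a b) : IsPathE P b a := by
  obtain ⟨l, hnd, hl, ha, hb, rfl⟩ := exists_list_of_isPathE h
  rw [← List.toFinset_eq_of_perm _ _ (pathEdges_reverse_perm l)]
  exact isPathE_of_list (List.nodup_reverse.2 hnd) (by simpa using hl) (by simpa using hb)
    (by simpa using ha)

theorem inter_toFinset_eq_empty {B₁ B₂ E : List (Sym2 α)} (hE : E.Nodup)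
    (hp : (B₁ ++ B₂).Perm E) : B₁.toFinset ∩ B₂.toFinset = ∅ := by
  have h := (List.nodup_append'.1 (hp.nodup_iff.2 hE)).2.2
  rw [← Finset.disjoint_iff_inter_eq_empty, Finset.disjoint_left]
  exact fun e h1 h2 => h (List.mem_toFinset.1 h1) (List.mem_toFinset.1 h2)

theorem union_toFinset_eq {B₁ B₂ E : List (Sym2 α)} (hp : (B₁ ++ B₂).Perm E) :
    B₁.toFinset ∪ B₂.toFinset = E.toFinset := by
  rw [← List.toFinset_append]
  exact List.toFinset_eq_of_perm _ _ hp

/-- Two edge lists that together trace two vertex-disjoint paths. -/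
theorem two_paths_of_perm {B₁ B₂ : List (Sym2 α)} {m₁ m₂ : List α} (hnd : (m₁ ++ m₂).Nodup)
    (hp : (B₁ ++ B₂).Perm (pathEdges m₁ ++ pathEdges m₂)) {a b p q : α}
    (hl₁ : 2 ≤ m₁.length) (hl₂ : 2 ≤ m₂.length)
    (ha : m₁.head? = some a) (hb : m₂.head? = some b)
    (hap : m₁.getLast? = some p) (hbq : m₂.getLast? = some q) :
    B₁.toFinset ∩ B₂.toFinset = ∅ ∧ ∃ R₁ R₂ : Finset (Sym2 α),
      IsPathE R₁ a p ∧ IsPathE R₂ b q ∧ Disjoint (VsetE R₁) (VsetE R₂) ∧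
      B₁.toFinset ∪ B₂.toFinset = R₁ ∪ R₂ := by
  rw [List.nodup_append'] at hnd
  refine ⟨inter_toFinset_eq_empty ?_ hp, _, _, isPathE_of_list hnd.1 hl₁ ha hap,
    isPathE_of_list hnd.2.1 hl₂ hb hbq, ?_, by rw [union_toFinset_eq hp, List.toFinset_append]⟩
  · rw [List.nodup_append']
    refine ⟨pathEdges_nodup hnd.1, pathEdges_nodup hnd.2.1, fun e h1 h2 => ?_⟩
    induction e using Sym2.ind with
    | _ x y =>
    exact hnd.2.2 (mem_of_mem_pathEdges h1 (Sym2.mem_mk_left x y))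
      (mem_of_mem_pathEdges h2 (Sym2.mem_mk_left x y))
  · rw [Set.disjoint_left]
    rintro v ⟨e, he, hve⟩ ⟨d, hd, hvd⟩
    exact hnd.2.2 (mem_of_mem_pathEdges (List.mem_toFinset.1 he) hve)
      (mem_of_mem_pathEdges (List.mem_toFinset.1 hd) hvd)

/-- The strand paths when both final links go to the same vertex form a single path. -/
theorem links_same_end (M : List (Seg α)) (a b x : α)
    (hnd : ([a, b, x] ++ segEnds M).Nodup) :
    (linkEdges a M x).toFinset ∩ (linkEdges b (M.map Seg.rev) x).toFinset = ∅ ∧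
      IsPathE ((linkEdges a M x).toFinset ∪ (linkEdges b (M.map Seg.rev) x).toFinset) b a := by
  obtain ⟨l₁, l₂, X', Y', hXY, hl, hp⟩ := exists_strands M a b x x
  obtain ⟨hX, hY⟩ : X' = x ∧ Y' = x := by tauto
  rw [hX, hY] at hp
  have hmid : (b :: l₂ ++ x :: (a :: l₁).reverse).Nodup := by
    refine List.Perm.nodup_iff ?_ |>.2 hnd
    rw [List.perm_iff_count]
    intro v
    have := hl.count_eq v
    simp only [List.count_append, List.count_cons, List.count_nil, List.cons_append,
      List.reverse_cons, List.count_reverse, List.nil_append] at this ⊢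
    omega
  have hperm : (linkEdges a M x ++ linkEdges b (M.map Seg.rev) x).Perm
      (pathEdges (b :: l₂ ++ x :: (a :: l₁).reverse)) := by
    refine hp.trans (List.perm_append_comm.trans ?_)
    obtain ⟨c, hc⟩ : ∃ c, (b :: l₂).getLast? = some c := by simp [List.getLast?_cons]
    rw [pathEdges_append hc (b := x) rfl, pathEdges_append hc (b := x) rfl]
    have := pathEdges_reverse_perm (a :: l₁ ++ [x])
    rw [List.reverse_append] at this
    simp only [pathEdges, List.append_assoc, List.cons_append, List.nil_append] at this ⊢
    exact (this.symm.cons _).append_left _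
  refine ⟨inter_toFinset_eq_empty (pathEdges_nodup hmid) hperm, ?_⟩
  rw [union_toFinset_eq hperm]
  refine isPathE_of_list hmid (by simp; omega) rfl ?_
  rw [List.reverse_cons, ← List.cons_append, ← List.append_assoc]
  exact List.getLast?_concat

/-- The strand paths when the final links go to distinct vertices `p` and `q`. -/
theorem links_two_ends (M : List (Seg α)) (a b p q : α)
    (hnd : ([a, b, p, q] ++ segEnds M).Nodup) :
    (linkEdges a M p).toFinset ∩ (linkEdges b (M.map Seg.rev) q).toFinset = ∅ ∧
      ∃ (R₁ R₂ : Finset (Sym2 α)) (p' q' : α), (p' = p ∧ q' = q ∨ p' = q ∧ q' = p) ∧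
        IsPathE R₁ a p' ∧ IsPathE R₂ b q' ∧ Disjoint (VsetE R₁) (VsetE R₂) ∧
        (linkEdges a M p).toFinset ∪ (linkEdges b (M.map Seg.rev) q).toFinset = R₁ ∪ R₂ := by
  obtain ⟨l₁, l₂, X', Y', hXY, hl, hp⟩ := exists_strands M a b p q
  have hmid : (a :: l₁ ++ [X'] ++ (b :: l₂ ++ [Y'])).Nodup := by
    refine List.Perm.nodup_iff ?_ |>.2 hnd
    rw [List.perm_iff_count]
    intro v
    have := hl.count_eq v
    rcases hXY with ⟨rfl, rfl⟩ | ⟨rfl, rfl⟩ <;>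
    · simp only [List.count_append, List.count_cons, List.count_nil, List.cons_append,
        List.nil_append] at this ⊢
      omega
  obtain ⟨h1, R₁, R₂, h⟩ := two_paths_of_perm hmid hp (p := X') (q := Y') (by simp) (by simp)
    rfl rfl List.getLast?_concat List.getLast?_concat
  exact ⟨h1, R₁, R₂, X', Y', hXY, h⟩

/-- The strand paths when each side is continued through one further segment. -/
theorem links_two_segs (M : List (Seg α)) (a b : α) (o m : Seg α)
    (hnd : ([a, b] ++ segEnds (o :: m :: M)).Nodup) :
    (linkEdges a (M ++ [m]) o.z).toFinset ∩
        (linkEdges b (M.map Seg.rev ++ [o]) m.z).toFinset = ∅ ∧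
      ∃ (R₁ R₂ : Finset (Sym2 α)) (p q : α), (p = o.w ∧ q = m.w ∨ p = m.w ∧ q = o.w) ∧
        IsPathE R₁ a p ∧ IsPathE R₂ b q ∧ Disjoint (VsetE R₁) (VsetE R₂) ∧
        (linkEdges a (M ++ [m]) o.z).toFinset ∪
          (linkEdges b (M.map Seg.rev ++ [o]) m.z).toFinset = R₁ ∪ R₂ := by
  obtain ⟨l₁, l₂, X', Y', hXY, hl, hp⟩ := exists_strands M a b m.z o.z
  have key : ∀ p q : α, (X' = m.z ∧ Y' = o.z ∧ p = o.w ∧ q = m.w ∨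
      X' = o.z ∧ Y' = m.z ∧ p = m.w ∧ q = o.w) →
      ((a :: l₁ ++ [X']) ++ [p] ++ ((b :: l₂ ++ [Y']) ++ [q])).Nodup ∧
      (linkEdges a (M ++ [m]) o.z ++ linkEdges b (M.map Seg.rev ++ [o]) m.z).Perm
        (pathEdges ((a :: l₁ ++ [X']) ++ [p]) ++ pathEdges ((b :: l₂ ++ [Y']) ++ [q])) := by
    intro p q hpq
    constructor
    · refine List.Perm.nodup_iff ?_ |>.2 hnd
      rw [List.perm_iff_count]
      intro v
      have := hl.count_eq v
      rw [show segEnds (o :: m :: M) = [o.z, o.w, m.z, m.w] ++ segEnds M from rfl]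
      rcases hpq with ⟨rfl, rfl, rfl, rfl⟩ | ⟨rfl, rfl, rfl, rfl⟩ <;>
      · simp only [List.count_append, List.count_cons, List.count_nil, List.cons_append,
          List.nil_append] at this ⊢
        omega
    · rw [pathEdges_append (l := a :: l₁ ++ [X']) (a := X') (b := p)
          List.getLast?_concat rfl,
        pathEdges_append (l := b :: l₂ ++ [Y']) (a := Y') (b := q)
          List.getLast?_concat rfl]
      refine ((linkEdges_append_singleton a M m o.z).append
        (linkEdges_append_singleton b (M.map Seg.rev) o m.z)).trans ?_
      rw [List.perm_iff_count]
      intro e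
      have := hp.count_eq e
      have hs1 : s(o.w, m.z) = s(m.z, o.w) := Sym2.eq_swap
      have hs2 : s(m.w, o.z) = s(o.z, m.w) := Sym2.eq_swap
      rcases hpq with ⟨rfl, rfl, rfl, rfl⟩ | ⟨rfl, rfl, rfl, rfl⟩ <;>
      · simp only [List.count_append, List.count_cons, pathEdges, List.count_nil, hs1, hs2]
          at this ⊢
        omega
  obtain ⟨p, q, hpq, hpq'⟩ : ∃ p q : α, (X' = m.z ∧ Y' = o.z ∧ p = o.w ∧ q = m.w ∨
      X' = o.z ∧ Y' = m.z ∧ p = m.w ∧ q = o.w) ∧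
      (p = o.w ∧ q = m.w ∨ p = m.w ∧ q = o.w) := by
    rcases hXY with ⟨h1, h2⟩ | ⟨h1, h2⟩
    · exact ⟨o.w, m.w, Or.inl ⟨h1, h2, rfl, rfl⟩, Or.inl ⟨rfl, rfl⟩⟩
    · exact ⟨m.w, o.w, Or.inr ⟨h1, h2, rfl, rfl⟩, Or.inr ⟨rfl, rfl⟩⟩
  obtain ⟨hmid, hperm⟩ := key p q hpq
  obtain ⟨h1, R₁, R₂, h⟩ := two_paths_of_perm hmid hperm (a := a) (b := b) (p := p) (q := q)
    (by simp) (by simp) (by simp) (by simp) List.getLast?_concat List.getLast?_concat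
  exact ⟨h1, R₁, R₂, p, q, hpq', h⟩

/-- A family of maximal paths of an acyclic 2-matching extends to a full decomposition. -/
theorem exists_segs_extending [Fintype α] (T : Finset (Sym2 α)) (hT : IsKMatching 2 T)
    (hac : AcyclicE T) (K : List (Seg α)) (hnd : (segVerts K).Nodup)
    (hKT : ∀ e ∈ segEdges K, e ∈ T)
    (hmax : ∀ e ∈ T, ∀ v ∈ e, v ∈ segVerts K → e ∈ segEdges K) :
    ∃ L : List (Seg α), (segVerts (K ++ L)).Nodup ∧ (∀ v, v ∈ segVerts (K ++ L)) ∧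
      ∀ e, e ∈ segEdges (K ++ L) ↔ e ∈ T := by
  have hsub : T.filter (· ∉ segEdges K) ⊆ T := Finset.filter_subset _ _
  obtain ⟨L, h1, h2, h3⟩ := exists_segs (Finset.univ.filter (· ∉ segVerts K))
    (T.filter (· ∉ segEdges K)) (hT.mono hsub) (hac.mono hsub) (by
      intro e he v hv
      rw [Finset.mem_filter] at he
      exact Finset.mem_filter.2 ⟨Finset.mem_univ v, fun h => he.2 (hmax e he.1 v hv h)⟩)
  have hV : segVerts (K ++ L) = segVerts K ++ segVerts L := by simp [segVerts]
  have hE : segEdges (K ++ L) = segEdges K ++ segEdges L := by simp [segEdges]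
  refine ⟨L, ?_, fun v => ?_, fun e => ?_⟩
  · rw [hV, List.nodup_append']
    exact ⟨hnd, h1, fun v hK hL => (Finset.mem_filter.1 ((h2 v).1 hL)).2 hK⟩
  · rw [hV, List.mem_append, h2, Finset.mem_filter]
    exact (em _).imp_right fun h => ⟨Finset.mem_univ v, h⟩
  · rw [hE, List.mem_append, h3, Finset.mem_filter]
    constructor
    · rintro (h | h)
      · exact hKT e h
      · exact h.1
    · exact fun h => (em _).imp_right fun h' => ⟨h, h'⟩

/-- `tour_of_segs` for a path cover obtained by joining two segments with an edge. -/
theorem tour_of_segEquiv {T F : Finset (Sym2 α)} (hT : SpanningE T) {o m : Seg α}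
    {M K : List (Seg α)} (hK : (segVerts K).Nodup) (hKF : ∀ e, e ∈ segEdges K ↔ e ∈ F)
    (hTF : ∀ e, e ∈ T ↔ e ∈ F ∨ e = s(o.w, m.z)) (hm : 3 ≤ m.l.length)
    (h : SegEquiv (m :: o :: M) K) :
    IsTourE (T ∪ (linkEdges m.w M o.z).toFinset) ∧
      VsetE (linkEdges m.w M o.z).toFinset = V1E T := by
  refine tour_of_segs T hT (o.app m) M ?_ ?_ fun e => ?_
  · refine List.Perm.nodup_iff ?_ |>.2 (h.1.nodup_iff.2 hK)
    rw [segVerts_cons, segVerts_cons, segVerts_cons, ← List.append_assoc m.l]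
    exact List.perm_append_comm.append_right _
  · rw [segVerts_cons, Seg.app, List.length_append, List.length_append]
    omega
  · rw [hTF, ← hKF, ← h.2.mem_iff]
    simp only [segEdges_cons, Seg.pathEdges_app, List.mem_append, List.mem_cons]
    tauto

end EdgeSets

/-- Lemma 13 of the paper. -/
theorem stmt12 (T1' T2' O1' : Finset (Sym2 V)) (v1 v2 v3 v4 v5 z1' w1' : V)
    (hT1 : IsPathCoverE T1') (hT2 : IsPathCoverE T2')
    (hdist : v1 ≠ v2 ∧ v1 ≠ v3 ∧ v1 ≠ v4 ∧ v2 ≠ v3 ∧ v2 ≠ v4 ∧ v3 ≠ v4)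
    (hv5 : v5 ≠ v2 ∧ v5 ≠ v3 ∧ v5 ≠ v4)
    (hd1 : T1' \ T2' = {s(v1, v2)}) (hd2 : T2' \ T1' = {s(v4, v5)})
    (hmid : MaxPathE (T1' ∩ T2') ({s(v2, v3), s(v3, v4)} : Finset (Sym2 V)))
    (hO1 : MaxPathE T1' O1') (hO2 : MaxPathE T2' O1') (hO : IsPathE O1' z1' w1') :
    ∃ B1' B2' : Finset (Sym2 V),
      B1' ∩ B2' = ∅ ∧
      IsTourE (T1' ∪ B1') ∧ IsTourE (T2' ∪ B2') ∧
      VsetE B1' = V1E T1' ∧ VsetE B2' = V1E T2' ∧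
      s(v4, z1') ∈ B1' ∧ s(v2, w1') ∈ B2' ∧
      (v5 = v1 → IsPathE (B1' ∪ B2') v2 v4) ∧
      (v5 ≠ v1 →
        ((∃ R1 R2 : Finset (Sym2 V), IsPathE R1 v1 v4 ∧ IsPathE R2 v2 v5 ∧
            Disjoint (VsetE R1) (VsetE R2) ∧ B1' ∪ B2' = R1 ∪ R2) ∨
         (∃ R1 R2 : Finset (Sym2 V), IsPathE R1 v1 v2 ∧ IsPathE R2 v4 v5 ∧
            Disjoint (VsetE R1) (VsetE R2) ∧ B1' ∪ B2' = R1 ∪ R2))) := by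
  obtain ⟨h12, h13, h14, h23, h24, h34⟩ := hdist
  obtain ⟨h52, h53, h54⟩ := hv5
  have he1 : s(v1, v2) ∈ T1' ∧ s(v1, v2) ∉ T2' := Finset.mem_sdiff.1 (hd1 ▸ by simp)
  have he2 : s(v4, v5) ∈ T2' ∧ s(v4, v5) ∉ T1' := Finset.mem_sdiff.1 (hd2 ▸ by simp)
  have hT1m : ∀ e, e ∈ T1' ↔ e ∈ T1' ∩ T2' ∨ e = s(v1, v2) := fun e => by
    have := congrArg (e ∈ ·) hd1
    simp only [Finset.mem_sdiff, Finset.mem_singleton, eq_iff_iff] at this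
    rw [Finset.mem_inter]
    tauto
  have hT2m : ∀ e, e ∈ T2' ↔ e ∈ T1' ∩ T2' ∨ e = s(v4, v5) := fun e => by
    have := congrArg (e ∈ ·) hd2
    simp only [Finset.mem_sdiff, Finset.mem_singleton, eq_iff_iff] at this
    rw [Finset.mem_inter]
    tauto
  have hsub1 : T1' ∩ T2' ⊆ T1' := Finset.inter_subset_left
  have hsub2 : T1' ∩ T2' ⊆ T2' := Finset.inter_subset_right
  have hO1T : O1' ⊆ T1' ∩ T2' := Finset.subset_inter hO1.1 hO2.1
  -- The common path avoids `v1`, `v2`, `v3`, `v4` and `v5`.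
  have hV1 : v1 ∉ VsetE O1' := fun h =>
    he1.2 (hO2.1 (hO1.2.2 _ he1.1 ⟨v1, by simp, h⟩))
  have hV2 : v2 ∉ VsetE O1' := fun h =>
    he1.2 (hO2.1 (hO1.2.2 _ he1.1 ⟨v2, by simp, h⟩))
  have hV4 : v4 ∉ VsetE O1' := fun h =>
    he2.2 (hO1.1 (hO2.2.2 _ he2.1 ⟨v4, by simp, h⟩))
  have hV5 : v5 ∉ VsetE O1' := fun h =>
    he2.2 (hO1.1 (hO2.2.2 _ he2.1 ⟨v5, by simp, h⟩))
  have hm23 : s(v2, v3) ∈ T1' ∩ T2' := hmid.1 (by simp)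
  have hV3 : v3 ∉ VsetE O1' := fun h =>
    hV2 ⟨_, hO1.2.2 _ (hsub1 hm23) ⟨v3, by simp, h⟩, by simp⟩
  obtain ⟨l1, hl1nd, hl1len, hl1z, hl1w, hl1E⟩ := exists_list_of_isPathE hO
  have hl1V : ∀ v, v ∈ l1 ↔ v ∈ VsetE O1' := by
    intro v
    constructor
    · intro hv
      obtain ⟨e, he, hve⟩ := exists_mem_pathEdges hl1len hv
      exact ⟨e, hl1E ▸ List.mem_toFinset.2 he, hve⟩
    · rintro ⟨e, he, hve⟩
      exact mem_of_mem_pathEdges (List.mem_toFinset.1 (hl1E ▸ he)) hve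
  have hl1E' : ∀ e, e ∈ pathEdges l1 ↔ e ∈ O1' := fun e => by
    rw [← hl1E, List.mem_toFinset]
  have hPV : ∀ v, v ∈ [v2, v3, v4] ↔
      v ∈ VsetE ({s(v2, v3), s(v3, v4)} : Finset (Sym2 V)) := fun v => by
    simp only [VsetE, Set.mem_ofPred_eq, Finset.mem_insert, Finset.mem_singleton,
      exists_eq_or_imp, exists_eq_left, Sym2.mem_iff, List.mem_cons, List.not_mem_nil]
    tauto
  obtain ⟨mid, hmidz, hmidw, hmidl⟩ :
      ∃ o : Seg V, o.z = v2 ∧ o.w = v4 ∧ o.l = [v2, v3, v4] :=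
    ⟨⟨v2, v4, _, rfl, rfl⟩, rfl, rfl, rfl⟩
  obtain ⟨o1, ho1z, ho1w, rfl⟩ : ∃ o : Seg V, o.z = z1' ∧ o.w = w1' ∧ o.l = l1 :=
    ⟨⟨z1', w1', l1, hl1z, hl1w⟩, rfl, rfl, rfl⟩
  have hmidE : ∀ e, e ∈ pathEdges mid.l ↔
      e ∈ ({s(v2, v3), s(v3, v4)} : Finset (Sym2 V)) := fun e => by
    simp [hmidl, pathEdges]
  -- Decompose the common edges, starting from the two given paths.
  have hKV : segVerts [mid, o1] = mid.l ++ o1.l := by simp [segVerts]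
  have hKE : segEdges [mid, o1] = pathEdges mid.l ++ pathEdges o1.l := by simp [segEdges]
  obtain ⟨L, hLnd, hLv, hLE⟩ := exists_segs_extending (T1' ∩ T2') (hT1.1.mono hsub1)
    (hT1.2.2.mono hsub1) [mid, o1]
    (by
      rw [hKV, List.nodup_append']
      refine ⟨by simp [hmidl, h23, h24, h34], hl1nd, fun v h1 h2 => ?_⟩
      rw [hl1V] at h2
      rw [hmidl] at h1
      simp only [List.mem_cons, List.not_mem_nil, or_false] at h1
      rcases h1 with rfl | rfl | rfl <;> contradiction)
    (by
      intro e he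
      rw [hKE, List.mem_append, hmidE, hl1E'] at he
      exact he.elim (fun h => hmid.1 h) fun h => hO1T h)
    (by
      intro e he v hve hv
      rw [hKV, List.mem_append, hmidl, hPV, hl1V] at hv
      rw [hKE, List.mem_append, hmidE, hl1E']
      exact hv.imp (fun h => hmid.2.2 e he ⟨v, hve, h⟩)
        fun h => hO1.2.2 e (hsub1 he) ⟨v, hve, h⟩)
  have hLV : ∀ v, v ∉ VsetE O1' → v ∉ [v2, v3, v4] → v ∈ segVerts L := by
    intro v h1 h2
    have h := hLv v
    rw [← hl1V] at h1
    rw [← hmidl] at h2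
    simp only [List.cons_append, segVerts_cons, List.mem_append] at h
    exact (h.resolve_left h2).resolve_left h1
  have hLE' : ∀ e ∈ segEdges L, e ∈ T1' ∩ T2' := fun e he =>
    (hLE e).1 (by simp [segEdges_cons, he])
  have hLnd' : (segVerts L).Nodup := hLnd.sublist
    ((List.sublist_append_right _ _).trans (List.sublist_append_right _ _))
  -- The segment that ends in `v1`.
  obtain ⟨Q, R, hQw, hQR⟩ := exists_seg_last hLnd' (u := v1)
    (hLV v1 hV1 (by simp [h12, h13, h14])) (by
      intro x y hx hy
      have hx := Finset.mem_inter.1 (hLE' _ hx)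
      have hy := Finset.mem_inter.1 (hLE' _ hy)
      refine eq_or_eq_of_degE_le_two (hT1.1.2 v1) hx.1 hy.1 he1.1 ?_ ?_
      · rintro rfl; exact he1.2 hx.2
      · rintro rfl; exact he1.2 hy.2)
  have hQeq : SegEquiv (mid :: Q :: o1 :: R) (mid :: o1 :: L) :=
    ((SegEquiv.of_perm (List.Perm.swap _ _ _)).trans (hQR.cons o1)).cons mid
  have hQnd := hQeq.1.nodup_iff.2 hLnd
  have hQE : ∀ e, e ∈ segEdges (mid :: Q :: o1 :: R) ↔ e ∈ T1' ∩ T2' := fun e =>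
    hQeq.2.mem_iff.trans (hLE e)
  -- No segment outside the first two is a single vertex.
  have hne : ∀ M : List (Seg V), (segVerts (mid :: Q :: M)).Nodup →
      (∀ e, e ∈ segEdges (mid :: Q :: M) ↔ e ∈ T1' ∩ T2') → ∀ o ∈ M, o.z ≠ o.w := by
    intro M hnd hE o ho
    refine Seg.z_ne_w (L := mid :: Q :: M) (by simp [ho]) hnd ?_
    obtain ⟨e, he, hv⟩ : o.z ∈ VsetE T1' := hT1.2.1 ▸ Set.mem_univ _
    rcases (hT1m e).1 he with h | rfl
    · exact ⟨e, (hE e).2 h, hv⟩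
    · exfalso
      have hoM : o.z ∈ segVerts M := List.mem_flatMap.2 ⟨o, ho, o.z_mem⟩
      rw [segVerts_cons, segVerts_cons, List.nodup_append', List.nodup_append'] at hnd
      rcases Sym2.mem_iff.1 hv with h | h
      · exact hnd.2.1.2.2 (hQw ▸ Q.w_mem) (h ▸ hoM)
      · exact hnd.2.2 (hmidz ▸ mid.z_mem) (List.mem_append_right _ (h ▸ hoM))
  have hdeg5 : ∀ x y, s(v5, x) ∈ T1' ∩ T2' → s(v5, y) ∈ T1' ∩ T2' → x = y := by
    intro x y hx hy
    refine eq_or_eq_of_degE_le_two (hT2.1.2 v5) (hsub2 hx) (hsub2 hy)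
      (by rw [Sym2.eq_swap]; exact he2.1) ?_ ?_
    · rintro rfl; rw [Sym2.eq_swap] at hx; exact he2.2 (hsub1 hx)
    · rintro rfl; rw [Sym2.eq_swap] at hy; exact he2.2 (hsub1 hy)
  have hmidsub : [v2, v4].Sublist mid.l := by simp [hmidl]
  have hmidlen : 3 ≤ mid.l.length := by simp [hmidl]
  have hmidlen' : 3 ≤ mid.rev.l.length := by simp [Seg.rev, hmidl]
  have hs1 : s(Q.w, mid.z) = s(v1, v2) := by rw [hQw, hmidz]
  have hmem1 : ∀ M x, s(v4, z1') ∈ (linkEdges mid.w (o1 :: M) x).toFinset := fun M x => by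
    simp [linkEdges, hmidw, ho1z]
  have hmem2 : ∀ M x, s(v2, w1') ∈ (linkEdges mid.rev.w (o1.rev :: M) x).toFinset := fun M x => by
    simp [linkEdges, Seg.rev, hmidz, ho1w]
  have hrevw : mid.rev.w = v2 := hmidz
  by_cases hv51 : v5 = v1
  · have htour1 := tour_of_segEquiv (M := o1 :: R) hT1.2.1 hQnd hQE (hs1 ▸ hT1m) hmidlen
      (.of_perm (.refl _))
    have hs2 : s(Q.w, mid.rev.z) = s(v4, v5) := by
      rw [hQw, hv51, Sym2.eq_swap]
      exact congrArg (s(·, v1)) hmidw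
    have htour2 := tour_of_segEquiv hT2.2.1 hQnd hQE (hs2 ▸ hT2m) hmidlen'
      (.rev_cons mid (.cons Q (.map_rev (o1 :: R))))
    obtain ⟨hdisj, hpath⟩ := links_same_end (o1 :: R) mid.w mid.rev.w Q.z (by
      rw [hmidw, hrevw]
      have hsub : ([v2, v4] ++ ([Q.z] ++ segEnds (o1 :: R))).Sublist
          (segVerts (mid :: Q :: o1 :: R)) :=
        hmidsub.append ((List.singleton_sublist.2 Q.z_mem).append
          (segEnds_sublist (hne _ hQnd hQE)))
      refine (List.Perm.nodup_iff ?_).2 (hQnd.sublist hsub)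
      exact List.Perm.swap _ _ _)
    rw [hmidw, hrevw] at hpath
    exact ⟨_, _, hdisj, htour1.1, htour2.1, htour1.2, htour2.2, hmem1 _ _, hmem2 _ _,
      fun _ => by rwa [hmidw, hrevw], fun h => absurd hv51 h⟩
  have hfinish : ∀ B₁ B₂ : Finset (Sym2 V), (∃ (R₁ R₂ : Finset (Sym2 V)) (p q : V),
      (p = v1 ∧ q = v5 ∨ p = v5 ∧ q = v1) ∧ IsPathE R₁ v4 p ∧ IsPathE R₂ v2 q ∧
        Disjoint (VsetE R₁) (VsetE R₂) ∧ B₁ ∪ B₂ = R₁ ∪ R₂) →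
      (∃ R1 R2 : Finset (Sym2 V), IsPathE R1 v1 v4 ∧ IsPathE R2 v2 v5 ∧
        Disjoint (VsetE R1) (VsetE R2) ∧ B₁ ∪ B₂ = R1 ∪ R2) ∨
      (∃ R1 R2 : Finset (Sym2 V), IsPathE R1 v1 v2 ∧ IsPathE R2 v4 v5 ∧
        Disjoint (VsetE R1) (VsetE R2) ∧ B₁ ∪ B₂ = R1 ∪ R2) := by
    rintro B₁ B₂ ⟨R₁, R₂, p, q, ⟨rfl, rfl⟩ | ⟨rfl, rfl⟩, h1, h2, h3, h4⟩
    · exact Or.inl ⟨R₁, R₂, h1.symm, h2, h3, h4⟩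
    · exact Or.inr ⟨R₂, R₁, h2.symm, h1, h3.symm, by rw [h4, Finset.union_comm]⟩
  by_cases h5Q : v5 ∈ Q.l
  · have hQz : Q.z = v5 := by
      have hQlnd : Q.l.Nodup := by
        rw [segVerts_cons, segVerts_cons, List.nodup_append', List.nodup_append'] at hQnd
        exact hQnd.2.1.1
      rcases eq_end_of_no_two_neighbors hQlnd h5Q Q.hz Q.hw (fun x y hx hy =>
        hdeg5 x y ((hQE _).1 (by simp [segEdges_cons, hx]))
          ((hQE _).1 (by simp [segEdges_cons, hy]))) with h | h
      · exact h.symm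
      · exact absurd (h.trans hQw) hv51
    have htour1 := tour_of_segEquiv (M := o1 :: R) hT1.2.1 hQnd hQE (hs1 ▸ hT1m) hmidlen
      (.of_perm (.refl _))
    have hs2 : s(Q.rev.w, mid.rev.z) = s(v4, v5) := by
      rw [← hQz, ← hmidw]
      exact Sym2.eq_swap
    have htour2 := tour_of_segEquiv hT2.2.1 hQnd hQE (hs2 ▸ hT2m) hmidlen'
      (.rev_cons mid (.rev_cons Q (.map_rev (o1 :: R))))
    obtain ⟨hdisj, R₁, R₂, p, q, hpq, hpath⟩ := links_two_ends (o1 :: R) mid.w mid.rev.w Q.z Q.w (by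
      rw [hmidw, hrevw]
      have hsub : ([v2, v4] ++ ([Q.z, Q.w] ++ segEnds (o1 :: R))).Sublist
          (segVerts (mid :: Q :: o1 :: R)) :=
        hmidsub.append ((Q.ends_sublist (by rw [hQz, hQw]; exact hv51)).append
          (segEnds_sublist (hne _ hQnd hQE)))
      refine (List.Perm.nodup_iff ?_).2 (hQnd.sublist hsub)
      exact List.Perm.swap _ _ _)
    refine ⟨_, _, hdisj, htour1.1, htour2.1, htour1.2, htour2.2, hmem1 _ _, hmem2 _ _,
      fun h => absurd h hv51, fun _ => hfinish _ _ ⟨R₁, R₂, p, q, ?_, ?_⟩⟩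
    · rw [hQz, hQw] at hpq
      exact hpq.symm
    · rw [← hmidw, ← hrevw]
      exact hpath
  · have h5R : v5 ∈ segVerts R := by
      have h := hQR.1.mem_iff.2 (hLV v5 hV5 (by simp [h52, h53, h54]))
      rw [segVerts_cons, List.mem_append] at h
      exact h.resolve_left h5Q
    have hRnd : (segVerts R).Nodup := by
      have h := hQR.1.nodup_iff.2 hLnd'
      rw [segVerts_cons, List.nodup_append'] at h
      exact h.2.1
    obtain ⟨Y, N, hYw, hYN⟩ := exists_seg_last hRnd h5R (fun x y hx hy =>
      hdeg5 x y ((hQE _).1 (by simp [segEdges_cons, hx]))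
        ((hQE _).1 (by simp [segEdges_cons, hy])))
    have hYeq : SegEquiv (mid :: Q :: Y :: o1 :: N) (mid :: Q :: o1 :: R) :=
      (((SegEquiv.of_perm (List.Perm.swap _ _ _)).trans (hYN.cons o1)).cons Q).cons mid
    have hYnd := hYeq.1.nodup_iff.2 hQnd
    have hYE : ∀ e, e ∈ segEdges (mid :: Q :: Y :: o1 :: N) ↔ e ∈ T1' ∩ T2' := fun e =>
      hYeq.2.mem_iff.trans (hQE e)
    have hQzw : Q.z ≠ Q.w := by
      refine fun hzw => Seg.z_ne_w (L := mid :: Q :: Y :: o1 :: N) (by simp) hYnd ?_ hzw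
      obtain ⟨e, he, hv⟩ : Q.z ∈ VsetE T2' := hT2.2.1 ▸ Set.mem_univ _
      rcases (hT2m e).1 he with h | rfl
      · exact ⟨e, (hYE e).2 h, hv⟩
      · rw [hzw, hQw] at hv
        rcases Sym2.mem_iff.1 hv with h | h
        · exact absurd h h14
        · exact absurd h.symm hv51
    have htour1 := tour_of_segEquiv (M := (o1 :: N) ++ [Y]) hT1.2.1 hYnd hYE (hs1 ▸ hT1m) hmidlen
      (.cons mid (.cons Q (.of_perm (List.perm_append_singleton Y (o1 :: N)))))
    have hs2 : s(Y.w, mid.rev.z) = s(v4, v5) := by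
      rw [hYw, ← hmidw]
      exact Sym2.eq_swap
    have htour2 := tour_of_segEquiv (M := (o1 :: N).map Seg.rev ++ [Q]) hT2.2.1 hYnd hYE
      (hs2 ▸ hT2m) hmidlen' (.rev_cons mid
        (((SegEquiv.of_perm (List.perm_append_singleton Q _)).trans
          (.cons Q (.map_rev (o1 :: N)))).cons Y |>.trans (.of_perm (List.Perm.swap _ _ _))))
    obtain ⟨hdisj, R₁, R₂, p, q, hpq, hpath⟩ := links_two_segs (o1 :: N) mid.w mid.rev.w Q Y (by
      rw [hmidw, hrevw]
      have hsub : ([v2, v4] ++ segEnds (Q :: Y :: o1 :: N)).Sublist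
          (segVerts (mid :: Q :: Y :: o1 :: N)) :=
        hmidsub.append (segEnds_sublist (List.forall_mem_cons.2 ⟨hQzw, hne _ hYnd hYE⟩))
      refine (List.Perm.nodup_iff ?_).2 (hYnd.sublist hsub)
      exact List.Perm.swap _ _ _)
    refine ⟨_, _, hdisj, htour1.1, htour2.1, htour1.2, htour2.2, hmem1 _ _, hmem2 _ _,
      fun h => absurd h hv51, fun _ => hfinish _ _ ⟨R₁, R₂, p, q, ?_, ?_⟩⟩
    · rwa [hQw, hYw] at hpq
    · rw [← hmidw, ← hrevw]
      exact hpath
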